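/- arXiv:1701.00645 — 2 statements merged into one kernel-verified Lean document; each statement's English description precedes it below -/
import Mathlib

section
/- Let M > K ≥ 1 and let X be a random M×K complex matrix whose entries are mutually independent, with every entry in column k distributed as CN(0, d_k) where d_k > 0 (so each row of X is CN(0, D) for the diagonal matrix D with diagonal entries d_1, …, d_K). Let D̂ be any (deterministic) K×K complex diagonal matrix. Then X^H X is almost surely invertible and E{Tr[ D̂ (X^H X)^{-1} ]} = (1/(M−K)) · Σ_{k=1}^{K} [D̂]_{kk} / d_k. -/
open MeasureTheory ProbabilityTheory Matrix

/-- Matrices inherit the (pi) measurable structure of functions. -/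
instance matrixMeasurableSpace {m n α : Type*} [MeasurableSpace α] :
    MeasurableSpace (Matrix m n α) :=
  inferInstanceAs (MeasurableSpace (m → n → α))

/-- The circularly-symmetric complex Gaussian distribution `CN(0, v)`:
real and imaginary parts are independent real Gaussians, each of variance `v/2`. -/
noncomputable def complexGaussian (v : ℝ) : Measure ℂ :=
  Measure.map (fun p : ℝ × ℝ => ⟨p.1, p.2⟩)
    ((gaussianReal 0 (v / 2).toNNReal).prod (gaussianReal 0 (v / 2).toNNReal))


section aux

open Complex in
lemma measurable_mkC : Measurable (fun p : ℝ × ℝ => (⟨p.1, p.2⟩ : ℂ)) :=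
  Complex.measurableEquivRealProd.symm.measurable

instance complexGaussian_prob (v : ℝ) : IsProbabilityMeasure (complexGaussian v) :=
  Measure.isProbabilityMeasure_map measurable_mkC.aemeasurable

lemma charFun_complexGaussian (v : ℝ) (hv : 0 < v) (s : ℂ) :
    charFun (complexGaussian v) s = Complex.exp (-(v / 4) * ‖s‖ ^ 2) := by
  have hm : Measurable (fun x : ℂ => Complex.exp ((inner ℝ x s : ℝ) * Complex.I)) := by fun_prop
  rw [charFun_apply, complexGaussian, integral_map measurable_mkC.aemeasurable
    hm.aestronglyMeasurable]
  have h1 : ∀ p : ℝ × ℝ, Complex.exp ((inner ℝ (⟨p.1, p.2⟩ : ℂ) s : ℝ) * Complex.I)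
      = Complex.exp (s.re * p.1 * Complex.I) * Complex.exp (s.im * p.2 * Complex.I) := by
    intro p
    rw [← Complex.exp_add, Complex.inner]
    congr 1
    simp [Complex.mul_re]
    ring
  simp_rw [h1]
  rw [integral_prod_mul (fun x : ℝ => Complex.exp (s.re * x * Complex.I))
    (fun x : ℝ => Complex.exp (s.im * x * Complex.I)), ← charFun_apply_real, ← charFun_apply_real,
    charFun_gaussianReal, charFun_gaussianReal, ← Complex.exp_add]
  congr 1
  have h2 : ((‖s‖ : ℂ)) ^ 2 = (s.re : ℂ) ^ 2 + (s.im : ℂ) ^ 2 := by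
    rw [← Complex.ofReal_pow, Complex.sq_norm, Complex.normSq_apply]; push_cast; ring
  rw [h2, Real.coe_toNNReal _ (by positivity)]
  push_cast
  ring

lemma integral_exp_sq_gaussian (w t : ℝ) (hw : 0 < w) (ht : 0 ≤ t) :
    ∫ x, Real.exp (-t * x ^ 2) ∂(gaussianReal 0 w.toNNReal) = (√(1 + 2 * t * w))⁻¹ := by
  rw [integral_gaussianReal_eq_integral_smul (by simpa using hw)]
  simp only [gaussianPDFReal, Real.coe_toNNReal _ hw.le, smul_eq_mul, sub_zero]
  have : ∀ x : ℝ, (√(2 * Real.pi * w))⁻¹ * Real.exp (-x ^ 2 / (2 * w)) * Real.exp (-t * x ^ 2)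
      = (√(2 * Real.pi * w))⁻¹ * Real.exp (-(1 / (2 * w) + t) * x ^ 2) := by
    intro x
    rw [mul_assoc, ← Real.exp_add]
    congr 2
    ring
  simp_rw [this]
  rw [integral_const_mul, integral_gaussian, ← Real.sqrt_inv, ← Real.sqrt_mul (by positivity),
    ← Real.sqrt_inv]
  congr 1
  have := Real.pi_pos
  field_simp
  

lemma integral_exp_complexGaussian (v t : ℝ) (hv : 0 < v) (ht : 0 ≤ t) :
    ∫ z, Real.exp (-t * ‖z‖ ^ 2) ∂(complexGaussian v) = (1 + t * v)⁻¹ := by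
  have hm : Measurable (fun z : ℂ => Real.exp (-t * ‖z‖ ^ 2)) := by fun_prop
  rw [complexGaussian, integral_map measurable_mkC.aemeasurable hm.aestronglyMeasurable]
  have h1 : ∀ p : ℝ × ℝ, Real.exp (-t * ‖(⟨p.1, p.2⟩ : ℂ)‖ ^ 2)
      = Real.exp (-t * p.1 ^ 2) * Real.exp (-t * p.2 ^ 2) := by
    intro p
    rw [← Real.exp_add, Complex.sq_norm, Complex.normSq_apply]
    congr 1
    ring
  simp_rw [h1]
  rw [integral_prod_mul (fun x : ℝ => Real.exp (-t * x ^ 2)) (fun x : ℝ => Real.exp (-t * x ^ 2)),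
    integral_exp_sq_gaussian _ _ (by positivity) ht, ← mul_inv, Real.mul_self_sqrt (by positivity)]
  congr 1
  ring

/-- law of a vector with iid `CN(0,v)` entries -/
noncomputable def cgVec (ι : Type*) [Fintype ι] (v : ℝ) : Measure (EuclideanSpace ℂ ι) :=
  (Measure.pi (fun _ : ι => complexGaussian v)).map (WithLp.toLp 2)

instance cgVec_prob (ι : Type*) [Fintype ι] (v : ℝ) : IsProbabilityMeasure (cgVec ι v) :=
  Measure.isProbabilityMeasure_map (by fun_prop)

lemma charFun_cgVec (ι : Type*) [Fintype ι] (v : ℝ) (hv : 0 < v) (s : EuclideanSpace ℂ ι) :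
    charFun (cgVec ι v) s = Complex.exp (-(v / 4) * ‖s‖ ^ 2) := by
  rw [cgVec, charFun_pi]
  simp_rw [charFun_complexGaussian v hv]
  rw [← Complex.exp_sum, ← Finset.mul_sum, ← Complex.ofReal_pow, EuclideanSpace.norm_sq_eq]
  push_cast
  rfl

lemma integral_exp_cgVec (ι : Type*) [Fintype ι] (v t : ℝ) (hv : 0 < v) (ht : 0 ≤ t) :
    ∫ y, Real.exp (-t * ‖y‖ ^ 2) ∂(cgVec ι v) = ((1 + t * v)⁻¹) ^ (Fintype.card ι) := by
  have hm : Measurable (fun z : EuclideanSpace ℂ ι => Real.exp (-t * ‖z‖ ^ 2)) := by fun_prop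
  rw [cgVec, integral_map (by fun_prop) hm.aestronglyMeasurable]
  have h1 : ∀ x : ι → ℂ, Real.exp (-t * ‖WithLp.toLp 2 x‖ ^ 2)
      = ∏ i, Real.exp (-t * ‖x i‖ ^ 2) := by
    intro x
    rw [← Real.exp_sum, ← Finset.mul_sum, EuclideanSpace.norm_sq_eq]
  simp_rw [h1]
  rw [integral_fintype_prod_eq_pow (fun z : ℂ => Real.exp (-t * ‖z‖ ^ 2)),
    integral_exp_complexGaussian v t hv ht]

lemma lintegral_exp_Ioi (a : ℝ) (ha : 0 ≤ a) :
    ∫⁻ t in Set.Ioi (0 : ℝ), ENNReal.ofReal (Real.exp (-t * a)) = (ENNReal.ofReal a)⁻¹ := by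
  rcases ha.eq_or_lt with rfl | ha
  · simp
  · have h := integral_exp_mul_Ioi (a := -a) (by linarith) 0
    have h' := integrableOn_exp_mul_Ioi (a := -a) (by linarith) 0
    have e : ∀ t : ℝ, -t * a = -a * t := fun t => by ring
    simp_rw [e]
    rw [← ofReal_integral_eq_lintegral_ofReal h' (ae_of_all _ fun _ => (Real.exp_pos _).le), h]
    simp [ENNReal.ofReal_inv_of_pos ha]

lemma lintegral_pow_Ioi (v : ℝ) (hv : 0 < v) (n : ℕ) (hn : 2 ≤ n) :
    ∫⁻ t in Set.Ioi (0 : ℝ), ENNReal.ofReal (((1 + t * v)⁻¹) ^ n)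
      = ENNReal.ofReal (1 / (v * (n - 1))) := by
  obtain ⟨m, rfl⟩ : ∃ m, n = m + 2 := ⟨n - 2, by omega⟩
  have hd : ∀ x ∈ Set.Ici (0 : ℝ), HasDerivAt
      (fun t : ℝ => -(1 / (v * (m + 1))) * ((1 + t * v)⁻¹) ^ (m + 1))
      (((1 + x * v)⁻¹) ^ (m + 2)) x := by
    intro x hx
    have hx' : 0 ≤ x := hx
    have hp : 1 + x * v ≠ 0 := by positivity
    have h1 : HasDerivAt (fun t : ℝ => 1 + t * v) v x := by
      simpa using ((hasDerivAt_id x).mul_const v).const_add 1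
    have h2 := ((h1.inv hp).pow (m + 1)).const_mul (-(1 / (v * (m + 1))))
    have e : -(1 / (v * (m + 1))) * (((m + 1 : ℕ) : ℝ) * ((1 + x * v)⁻¹) ^ m *
        (-v / (1 + x * v) ^ 2)) = ((1 + x * v)⁻¹) ^ (m + 2) := by
      have : (m : ℝ) + 1 ≠ 0 := by positivity
      push_cast
      rw [pow_add]
      field_simp
    rw [← e]
    exact h2
  have ht : Filter.Tendsto (fun t : ℝ => -(1 / (v * (m + 1))) * ((1 + t * v)⁻¹) ^ (m + 1))
      Filter.atTop (nhds 0) := by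
    have h1 : Filter.Tendsto (fun t : ℝ => 1 + t * v) Filter.atTop Filter.atTop :=
      Filter.tendsto_atTop_add_const_left _ _ (Filter.tendsto_id.atTop_mul_const hv)
    have h2 := ((tendsto_inv_atTop_zero.comp h1).pow (m + 1)).const_mul (-(1 / (v * (m + 1))))
    simpa using h2
  have hpos : ∀ x ∈ Set.Ioi (0 : ℝ), 0 ≤ ((1 + x * v)⁻¹) ^ (m + 2) := by
    intro x hx
    have hx' : 0 < x := hx
    positivity
  have hi := integrableOn_Ioi_deriv_of_nonneg' hd hpos ht
  have hI := integral_Ioi_of_hasDerivAt_of_nonneg' hd hpos ht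
  rw [← ofReal_integral_eq_lintegral_ofReal hi ((ae_restrict_iff' measurableSet_Ioi).2
    (ae_of_all _ hpos)), hI]
  congr 1
  push_cast
  simp only [zero_mul, add_zero, inv_one, one_pow]
  ring

lemma lintegral_inv_cgVec (v : ℝ) (hv : 0 < v) (n : ℕ) (hn : 2 ≤ n) :
    ∫⁻ y, (ENNReal.ofReal (‖y‖ ^ 2))⁻¹ ∂(cgVec (Fin n) v)
      = ENNReal.ofReal (1 / (v * (n - 1))) := by
  have h1 : ∀ y : EuclideanSpace ℂ (Fin n), (ENNReal.ofReal (‖y‖ ^ 2))⁻¹ =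
      ∫⁻ t in Set.Ioi (0 : ℝ), ENNReal.ofReal (Real.exp (-t * ‖y‖ ^ 2)) :=
    fun y => (lintegral_exp_Ioi _ (by positivity)).symm
  simp_rw [h1]
  rw [lintegral_lintegral_swap (by fun_prop), ← lintegral_pow_Ioi v hv n hn]
  refine setLIntegral_congr_fun measurableSet_Ioi fun t ht => ?_
  have ht' : 0 ≤ t := le_of_lt ht
  have := integral_exp_cgVec (Fin n) v t hv ht'
  rw [Fintype.card_fin] at this
  rw [← this, ofReal_integral_eq_lintegral_ofReal _ (ae_of_all _ fun _ => (Real.exp_pos _).le)]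
  refine Integrable.of_bound (C := 1) (by fun_prop) (ae_of_all _ fun y => ?_)
  rw [Real.norm_of_nonneg (Real.exp_pos _).le]
  exact Real.exp_le_one_iff.2 (by nlinarith [sq_nonneg ‖y‖])

lemma map_cgVec {ι κ : Type*} [Fintype ι] [Fintype κ] (v : ℝ) (hv : 0 < v)
    (L : EuclideanSpace ℂ κ → EuclideanSpace ℂ ι) (hL : ∀ s, ‖L s‖ = ‖s‖)
    (T : EuclideanSpace ℂ ι → EuclideanSpace ℂ κ) (hT : Measurable T)
    (hLT : ∀ x s, inner ℝ (T x) s = inner ℝ x (L s)) :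
    (cgVec ι v).map T = cgVec κ v := by
  have : IsProbabilityMeasure ((cgVec ι v).map T) := Measure.isProbabilityMeasure_map hT.aemeasurable
  refine Measure.ext_of_charFun ?_
  ext s
  rw [charFun_cgVec _ _ hv, ← hL s, ← charFun_cgVec _ _ hv, charFun_apply, charFun_apply,
    integral_map hT.aemeasurable (by fun_prop)]
  simp_rw [hLT]

lemma inner_real_eq {ι : Type*} [Fintype ι] (x y : EuclideanSpace ℂ ι) :
    (inner ℝ x y : ℝ) = (inner ℂ x y : ℂ).re := by
  simp [PiLp.inner_apply, Complex.inner, mul_comm]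

lemma lintegral_inv_proj (v : ℝ) (hv : 0 < v) (M n : ℕ) (hn : 2 ≤ n)
    (V : Submodule ℂ (EuclideanSpace ℂ (Fin M))) (hV : Module.finrank ℂ V = n) :
    ∫⁻ x, (ENNReal.ofReal (‖V.orthogonalProjectionOnto x‖ ^ 2))⁻¹ ∂(cgVec (Fin M) v)
      = ENNReal.ofReal (1 / (v * (n - 1))) := by
  let b : OrthonormalBasis (Fin n) ℂ V := (stdOrthonormalBasis ℂ V).reindex (finCongr hV)
  let T : EuclideanSpace ℂ (Fin M) → EuclideanSpace ℂ (Fin n) :=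
    fun x => b.repr (V.orthogonalProjectionOnto x)
  have hT : Measurable T := by
    have : Continuous T := by fun_prop
    exact this.measurable
  have h := map_cgVec (ι := Fin M) (κ := Fin n) v hv (fun s => (b.repr.symm s : EuclideanSpace ℂ (Fin M)))
    (fun s => b.repr.symm.norm_map s) T hT (fun x s => by
      rw [inner_real_eq, inner_real_eq]
      congr 1
      rw [← Submodule.inner_orthogonalProjectionOnto_eq_of_mem_right]
      rw [← b.repr.symm.inner_map_map]
      simp [T])
  rw [← lintegral_inv_cgVec v hv n hn, ← h, lintegral_map (by fun_prop) hT]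
  simp [T]

lemma cgVec_submodule_null (v : ℝ) (hv : 0 < v) (M : ℕ)
    (V : Submodule ℂ (EuclideanSpace ℂ (Fin M))) (hV : Module.finrank ℂ V + 2 ≤ M) :
    ∀ᵐ x ∂(cgVec (Fin M) v), x ∉ V := by
  have hn := V.finrank_add_finrank_orthogonal
  rw [finrank_euclideanSpace, Fintype.card_fin] at hn
  have h := lintegral_inv_proj v hv M _ (by omega) Vᗮ rfl
  have hm : Measurable fun x : EuclideanSpace ℂ (Fin M) =>
      (ENNReal.ofReal (‖Vᗮ.orthogonalProjectionOnto x‖ ^ 2))⁻¹ := by fun_prop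
  have := ae_lt_top hm (by rw [h]; exact ENNReal.ofReal_ne_top)
  filter_upwards [this] with x hx hxV
  rw [Submodule.orthogonalProjectionOnto_orthogonal_apply_eq_zero hxV] at hx
  simp at hx

end aux

section aux2

lemma gram_inv_apply {E : Type*} [NormedAddCommGroup E] [InnerProductSpace ℂ E]
    [FiniteDimensional ℂ E] {K : ℕ} (v : Fin K → E) (hv : LinearIndependent ℂ v) (k : Fin K) :
    (gram ℂ v)⁻¹ k k =
      (((‖(Submodule.span ℂ (v '' {k}ᶜ))ᗮ.orthogonalProjectionOnto (v k)‖ ^ 2)⁻¹ : ℝ) : ℂ) := by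
  set G := gram ℂ v with hG
  have hdet : IsUnit G.det := isUnit_iff_ne_zero.2 (det_gram_ne_zero_iff_linearIndependent.2 hv)
  set V := Submodule.span ℂ (v '' {k}ᶜ) with hV
  set c : Fin K → ℂ := fun j => G⁻¹ j k with hc
  set w : E := ∑ j, c j • v j with hw
  have h1 : ∀ i, inner ℂ (v i) w = if i = k then 1 else 0 := by
    intro i
    have : (G * G⁻¹) i k = (1 : Matrix (Fin K) (Fin K) ℂ) i k := by rw [mul_nonsing_inv _ hdet]
    rw [Matrix.mul_apply, Matrix.one_apply] at this
    rw [← this, hw, inner_sum]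
    refine Finset.sum_congr rfl fun j _ => ?_
    rw [inner_smul_right, hG, gram_apply, mul_comm]
  have h2 : inner ℂ w w = (starRingEnd ℂ) (c k) := by
    conv_lhs => rw [hw, sum_inner]
    simp_rw [inner_smul_left]
    rw [← hw]
    simp_rw [h1]
    simp
  have h3 : c k = ((‖w‖ ^ 2 : ℝ) : ℂ) := by
    rw [inner_self_eq_norm_sq_to_K] at h2
    have := congrArg (starRingEnd ℂ) h2
    rw [Complex.conj_conj] at this
    rw [← this]
    simp
  have hw0 : w ≠ 0 := by
    intro h0
    have := h1 k
    rw [h0] at this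
    simp at this
  have hn : ‖w‖ ≠ 0 := norm_ne_zero_iff.2 hw0
  have hck : c k ≠ 0 := by
    rw [h3]
    exact_mod_cast pow_ne_zero 2 hn
  have hwV : w ∈ Vᗮ := by
    rw [hV, Submodule.mem_orthogonal]
    intro u hu
    induction hu using Submodule.span_induction with
    | mem x hx =>
      obtain ⟨j, hj, rfl⟩ := hx
      rw [h1, if_neg (by simpa using hj)]
    | zero => simp
    | add x y _ _ hx hy => rw [inner_add_left, hx, hy, add_zero]
    | smul a x _ hx => rw [inner_smul_left, hx, mul_zero]
  have hsplit : w = c k • v k + ∑ j ∈ Finset.univ.erase k, c j • v j := by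
    rw [hw, Finset.add_sum_erase _ (fun j => c j • v j) (Finset.mem_univ k)]
  have hr : (∑ j ∈ Finset.univ.erase k, c j • v j) ∈ V := by
    refine Submodule.sum_mem _ fun j hj => Submodule.smul_mem _ _ (Submodule.subset_span ⟨j, ?_, rfl⟩)
    simpa using hj
  have hP : Vᗮ.orthogonalProjectionOnto w = c k • Vᗮ.orthogonalProjectionOnto (v k) := by
    conv_lhs => rw [hsplit]
    rw [map_add, map_smul, Submodule.orthogonalProjectionOnto_orthogonal_apply_eq_zero hr, add_zero]
  have hPw : ‖Vᗮ.orthogonalProjectionOnto w‖ = ‖w‖ := by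
    rw [Submodule.orthogonalProjectionOnto_mem_subspace_eq_self (⟨w, hwV⟩ : Vᗮ)]
    rfl
  have hnorm : ‖w‖ = ‖w‖ ^ 2 * ‖Vᗮ.orthogonalProjectionOnto (v k)‖ := by
    have h4 : ‖c k‖ = ‖w‖ ^ 2 := by
      rw [h3, Complex.norm_real, Real.norm_of_nonneg (by positivity)]
    rw [← h4, ← norm_smul, ← hP, hPw]
  have hp : ‖Vᗮ.orthogonalProjectionOnto (v k)‖ = ‖w‖⁻¹ := by
    field_simp
    have : ‖w‖ * (‖w‖ * ‖Vᗮ.orthogonalProjectionOnto (v k)‖) = ‖w‖ * 1 := by nlinarith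
    simpa [mul_comm] using mul_left_cancel₀ hn this
  change c k = _
  rw [hp, h3]
  simp

variable {Ω : Type*} [MeasurableSpace Ω] {μ : Measure Ω} [IsProbabilityMeasure μ]
  {M K : ℕ} {d : Fin K → ℝ} {C : Ω → Fin K → EuclideanSpace ℂ (Fin M)}

lemma joint_law (hC : Measurable C)
    (hind : ∀ k, IndepFun (fun ω => Function.update (C ω) k 0) (fun ω => C ω k) μ)
    (hlaw : ∀ k, μ.map (fun ω => C ω k) = cgVec (Fin M) (d k)) (k : Fin K) :
    μ.map (fun ω => (Function.update (C ω) k 0, C ω k)) =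
      (μ.map (fun ω => Function.update (C ω) k 0)).prod (cgVec (Fin M) (d k)) := by
  rw [← hlaw k]
  refine (indepFun_iff_map_prod_eq_prod_map_map ?_ ?_).1 (hind k)
  · exact (by fun_prop : Measurable fun ω => Function.update (C ω) k 0).aemeasurable
  · exact (by fun_prop : Measurable fun ω => C ω k).aemeasurable

lemma measurableSet_li (S : Finset (Fin K)) :
    MeasurableSet {v : Fin K → EuclideanSpace ℂ (Fin M) | LinearIndepOn ℂ v (S : Set (Fin K))} := by
  have h : MeasurableSet {v : ↥(S : Set (Fin K)) → EuclideanSpace ℂ (Fin M) | LinearIndependent ℂ v} :=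
    isOpen_setOfPred_linearIndependent.measurableSet
  have hf : Measurable (fun (v : Fin K → EuclideanSpace ℂ (Fin M)) (j : (S : Set (Fin K))) => v j) :=
    by fun_prop
  exact hf h

lemma measurable_upd (k : Fin K) :
    Measurable (fun p : (Fin K → EuclideanSpace ℂ (Fin M)) × EuclideanSpace ℂ (Fin M) =>
      Function.update p.1 k p.2) := by
  refine measurable_pi_lambda _ fun j => ?_
  by_cases h : j = k
  · subst h; simpa using measurable_snd
  · simp only [Function.update_of_ne h]; fun_prop

lemma ae_li (hMK : K < M) (hd : ∀ k, 0 < d k) (hC : Measurable C)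
    (hind : ∀ k, IndepFun (fun ω => Function.update (C ω) k 0) (fun ω => C ω k) μ)
    (hlaw : ∀ k, μ.map (fun ω => C ω k) = cgVec (Fin M) (d k)) (S : Finset (Fin K)) :
    ∀ᵐ ω ∂μ, LinearIndepOn ℂ (C ω) (S : Set (Fin K)) := by
  induction S using Finset.induction_on with
  | empty => simp
  | insert k S hk ih =>
    have hjm : Measurable (fun ω => (Function.update (C ω) k 0, C ω k)) := by fun_prop
    have hrm : Measurable (fun ω => Function.update (C ω) k 0) := by fun_prop
    have hset : MeasurableSet {p : (Fin K → EuclideanSpace ℂ (Fin M)) × EuclideanSpace ℂ (Fin M) |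
        LinearIndepOn ℂ (Function.update p.1 k p.2) ((insert k S : Finset (Fin K)) : Set (Fin K))} :=
      (measurableSet_li (insert k S)).preimage (measurable_upd k)
    have key : ∀ᵐ p ∂(μ.map (fun ω => (Function.update (C ω) k 0, C ω k))),
        LinearIndepOn ℂ (Function.update p.1 k p.2) ((insert k S : Finset (Fin K)) : Set (Fin K)) := by
      rw [joint_law hC hind hlaw k, Measure.ae_prod_iff_ae_ae hset]
      have hS : ∀ᵐ r ∂(μ.map (fun ω => Function.update (C ω) k 0)),
          LinearIndepOn ℂ r (S : Set (Fin K)) := by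
        rw [ae_map_iff hrm.aemeasurable (measurableSet_li S)]
        filter_upwards [ih] with ω hω
        refine hω.congr fun j hj => ?_
        rw [Function.update_of_ne]
        rintro rfl
        exact hk (by simpa using hj)
      filter_upwards [hS] with r hr
      have hcard : S.card < K := by
        have := Finset.card_lt_univ_of_notMem hk
        simpa using this
      have hfin : Module.finrank ℂ (Submodule.span ℂ (r '' (S : Set (Fin K)))) + 2 ≤ M := by
        have : Module.finrank ℂ (Submodule.span ℂ (r '' (S : Set (Fin K)))) ≤ S.card := by
          classical
          have h1 := finrank_span_finset_le_card (R := ℂ) (S.image r)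
          rw [Finset.coe_image] at h1
          exact h1.trans Finset.card_image_le
        omega
      filter_upwards [cgVec_submodule_null (d k) (hd k) M _ hfin] with x hx
      have heq : Set.EqOn (Function.update r k x) r (S : Set (Fin K)) := by
        intro j hj
        rw [Function.update_of_ne]
        rintro rfl
        exact hk (by simpa using hj)
      rw [Finset.coe_insert, linearIndepOn_insert (by simpa using hk), heq.image_eq,
        Function.update_self]
      exact ⟨hr.congr heq.symm, hx⟩
    rw [ae_map_iff hjm.aemeasurable hset] at key
    filter_upwards [key] with ω hω
    simpa using hω

lemma measurable_gram_inv (k : Fin K) :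
    Measurable (fun v : Fin K → EuclideanSpace ℂ (Fin M) => (gram ℂ v)⁻¹ k k) := by
  have hg : Continuous (fun v : Fin K → EuclideanSpace ℂ (Fin M) => gram ℂ v) := by
    refine continuous_matrix fun i j => ?_
    simp only [gram_apply]
    fun_prop
  have h1 : Measurable (fun v : Fin K → EuclideanSpace ℂ (Fin M) => (gram ℂ v).det) :=
    hg.matrix_det.measurable
  have h2 : Measurable (fun v : Fin K → EuclideanSpace ℂ (Fin M) => (gram ℂ v).adjugate k k) :=
    (hg.matrix_adjugate.matrix_elem k k).measurable
  simp only [Matrix.inv_def, Ring.inverse_eq_inv', Matrix.smul_apply, smul_eq_mul]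
  exact h1.inv.mul h2

lemma lintegral_gram_inv (hMK : K < M) (hd : ∀ k, 0 < d k) (hC : Measurable C)
    (hind : ∀ k, IndepFun (fun ω => Function.update (C ω) k 0) (fun ω => C ω k) μ)
    (hlaw : ∀ k, μ.map (fun ω => C ω k) = cgVec (Fin M) (d k)) (k : Fin K) :
    ∫⁻ ω, ENNReal.ofReal ((gram ℂ (C ω))⁻¹ k k).re ∂μ = ENNReal.ofReal (1 / (d k * (M - K))) := by
  have hjm : Measurable (fun ω => (Function.update (C ω) k 0, C ω k)) := by fun_prop
  have hrm : Measurable (fun ω => Function.update (C ω) k 0) := by fun_prop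
  have hprob : IsProbabilityMeasure (μ.map (fun ω => Function.update (C ω) k 0)) :=
    Measure.isProbabilityMeasure_map hrm.aemeasurable
  have hf : Measurable (fun p : (Fin K → EuclideanSpace ℂ (Fin M)) × EuclideanSpace ℂ (Fin M) =>
      ENNReal.ofReal ((gram ℂ (Function.update p.1 k p.2))⁻¹ k k).re) :=
    (Complex.measurable_re.comp ((measurable_gram_inv k).comp (measurable_upd k))).ennreal_ofReal
  have h1 : ∫⁻ ω, ENNReal.ofReal ((gram ℂ (C ω))⁻¹ k k).re ∂μ =
      ∫⁻ p, ENNReal.ofReal ((gram ℂ (Function.update p.1 k p.2))⁻¹ k k).re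
        ∂(μ.map (fun ω => (Function.update (C ω) k 0, C ω k))) := by
    rw [lintegral_map hf hjm]
    simp
  have hset : MeasurableSet {p : (Fin K → EuclideanSpace ℂ (Fin M)) × EuclideanSpace ℂ (Fin M) |
      LinearIndepOn ℂ (Function.update p.1 k p.2) ((Finset.univ : Finset (Fin K)) : Set (Fin K))} :=
    (measurableSet_li Finset.univ).preimage (measurable_upd k)
  have key : ∀ᵐ p ∂(μ.map (fun ω => (Function.update (C ω) k 0, C ω k))),
      LinearIndepOn ℂ (Function.update p.1 k p.2) ((Finset.univ : Finset (Fin K)) : Set (Fin K)) := by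
    rw [ae_map_iff hjm.aemeasurable hset]
    filter_upwards [ae_li hMK hd hC hind hlaw Finset.univ] with ω hω
    simpa using hω
  rw [joint_law hC hind hlaw k] at key h1
  rw [h1, lintegral_prod _ hf.aemeasurable]
  rw [Measure.ae_prod_iff_ae_ae hset] at key
  have hinner : ∀ᵐ r ∂(μ.map (fun ω => Function.update (C ω) k 0)),
      ∫⁻ x, ENNReal.ofReal ((gram ℂ (Function.update r k x))⁻¹ k k).re ∂(cgVec (Fin M) (d k))
        = ENNReal.ofReal (1 / (d k * (M - K))) := by
    filter_upwards [key] with r hr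
    have heq : ∀ x, Set.EqOn (Function.update r k x) r {k}ᶜ := by
      intro x j hj
      rw [Function.update_of_ne (by simpa using hj)]
    have hli : LinearIndepOn ℂ r {k}ᶜ := by
      obtain ⟨x, hx⟩ := hr.exists
      exact (hx.mono (by simp)).congr (heq x)
    set V := Submodule.span ℂ (r '' {k}ᶜ) with hV
    have hfr : Module.finrank ℂ V = K - 1 := by
      have h2 := finrank_span_eq_card (R := ℂ) hli.linearIndependent
      rw [hV, Set.image_eq_range, h2, Fintype.card_compl_set]
      simp
    have hfo := V.finrank_add_finrank_orthogonal
    rw [finrank_euclideanSpace, Fintype.card_fin] at hfo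
    have hK : 1 ≤ K := k.pos
    have hn : Module.finrank ℂ Vᗮ = M - K + 1 := by omega
    have h3 := lintegral_inv_proj (d k) (hd k) M (M - K + 1) (by omega) Vᗮ hn
    have h4 : ((M - K + 1 : ℕ) : ℝ) - 1 = M - K := by
      push_cast [Nat.cast_sub hMK.le]; ring
    rw [h4] at h3
    rw [← h3]
    have hVd : Module.finrank ℂ V + 2 ≤ M := by omega
    refine lintegral_congr_ae ?_
    filter_upwards [hr, cgVec_submodule_null (d k) (hd k) M V hVd] with x hx hxV
    have hx' : LinearIndependent ℂ (Function.update r k x) := by simpa using hx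
    rw [gram_inv_apply _ hx' k, (heq x).image_eq, Function.update_self, Complex.ofReal_re,
      ENNReal.ofReal_inv_of_pos]
    have : Vᗮ.orthogonalProjectionOnto x ≠ 0 := by
      rw [Ne, Submodule.orthogonalProjectionOnto_eq_zero_iff, Submodule.orthogonal_orthogonal]
      exact hxV
    have := norm_pos_iff.2 this
    positivity
  rw [lintegral_congr_ae hinner]
  simp

lemma integral_gram_inv (hMK : K < M) (hd : ∀ k, 0 < d k) (hC : Measurable C)
    (hind : ∀ k, IndepFun (fun ω => Function.update (C ω) k 0) (fun ω => C ω k) μ)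
    (hlaw : ∀ k, μ.map (fun ω => C ω k) = cgVec (Fin M) (d k)) (k : Fin K) :
    Integrable (fun ω => (gram ℂ (C ω))⁻¹ k k) μ ∧
    ∫ ω, (gram ℂ (C ω))⁻¹ k k ∂μ = ((1 / (d k * (M - K)) : ℝ) : ℂ) := by
  have h := lintegral_gram_inv hMK hd hC hind hlaw k
  have hm : Measurable (fun ω => ((gram ℂ (C ω))⁻¹ k k).re) :=
    Complex.measurable_re.comp ((measurable_gram_inv k).comp hC)
  have hae : ∀ᵐ ω ∂μ, (gram ℂ (C ω))⁻¹ k k = ((((gram ℂ (C ω))⁻¹ k k).re : ℝ) : ℂ) ∧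
      0 ≤ ((gram ℂ (C ω))⁻¹ k k).re := by
    filter_upwards [ae_li hMK hd hC hind hlaw Finset.univ] with ω hω
    have hx' : LinearIndependent ℂ (C ω) := by simpa using hω
    rw [gram_inv_apply _ hx' k, Complex.ofReal_re]
    exact ⟨rfl, by positivity⟩
  have hnn : 0 ≤ᵐ[μ] fun ω => ((gram ℂ (C ω))⁻¹ k k).re := hae.mono fun _ h => h.2
  have hint : Integrable (fun ω => ((gram ℂ (C ω))⁻¹ k k).re) μ := by
    refine (lintegral_ofReal_ne_top_iff_integrable hm.aestronglyMeasurable hnn).1 ?_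
    rw [h]
    exact ENNReal.ofReal_ne_top
  have hval : ∫ ω, ((gram ℂ (C ω))⁻¹ k k).re ∂μ = 1 / (d k * (M - K)) := by
    rw [integral_eq_lintegral_of_nonneg_ae hnn hm.aestronglyMeasurable, h, ENNReal.toReal_ofReal]
    have : (0 : ℝ) < M - K := by
      have : (K : ℝ) < M := by exact_mod_cast hMK
      linarith
    have := hd k
    positivity
  have hae' : (fun ω => (gram ℂ (C ω))⁻¹ k k) =ᵐ[μ]
      fun ω => ((((gram ℂ (C ω))⁻¹ k k).re : ℝ) : ℂ) := hae.mono fun _ h => h.1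
  refine ⟨(hint.ofReal (𝕜 := ℂ)).congr hae'.symm, ?_⟩
  rw [integral_congr_ae hae', integral_complex_ofReal, hval]

end aux2

theorem stmt_0
    {Ω : Type*} [MeasurableSpace Ω] (μ : Measure Ω) [IsProbabilityMeasure μ]
    (M K : ℕ) (hK : 1 ≤ K) (hMK : K < M)
    (d : Fin K → ℝ) (hd : ∀ k, 0 < d k)
    (X : Ω → Matrix (Fin M) (Fin K) ℂ) (hX : Measurable X)
    (hindep : iIndepFun
      (fun (p : Fin M × Fin K) ω => X ω p.1 p.2) μ)
    (hdist : ∀ i k, μ.map (fun ω => X ω i k) = complexGaussian (d k))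
    (Dhat : Matrix (Fin K) (Fin K) ℂ) (hDhat : ∀ i j, i ≠ j → Dhat i j = 0) :
    (∀ᵐ ω ∂μ, IsUnit ((X ω)ᴴ * X ω)) ∧
      ∫ ω, Matrix.trace (Dhat * ((X ω)ᴴ * X ω)⁻¹) ∂μ
        = (1 / ((M : ℂ) - (K : ℂ))) * ∑ k, Dhat k k / (d k : ℂ) := by
  classical
  set C : Ω → Fin K → EuclideanSpace ℂ (Fin M) := fun ω k => WithLp.toLp 2 (fun i => X ω i k)
    with hCdef
  have hX' : Measurable (fun ω => (X ω : Fin M → Fin K → ℂ)) := hX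
  have hent : ∀ i k, Measurable (fun ω => X ω i k) := fun i k =>
    measurable_pi_iff.1 (measurable_pi_iff.1 hX' i) k
  have hC : Measurable C := by
    refine measurable_pi_lambda _ fun k => ?_
    exact (by fun_prop : Measurable (WithLp.toLp 2 : (Fin M → ℂ) → EuclideanSpace ℂ (Fin M))).comp
      (measurable_pi_lambda _ fun i => hent i k)
  have hgram : ∀ ω, (X ω)ᴴ * X ω = gram ℂ (C ω) := by
    intro ω
    ext i j
    simp [Matrix.mul_apply, gram_apply, PiLp.inner_apply, hCdef, mul_comm]
  have hlaw : ∀ k, μ.map (fun ω => C ω k) = cgVec (Fin M) (d k) := by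
    intro k
    have h1 : iIndepFun (fun (i : Fin M) ω => X ω i k) μ :=
      hindep.precomp (g := fun i : Fin M => (i, k)) (fun a b h => by simpa using h)
    have h2 := (iIndepFun_iff_map_fun_eq_pi_map (fun i => (hent i k).aemeasurable)).1 h1
    simp_rw [hdist] at h2
    rw [cgVec, ← h2, Measure.map_map (by fun_prop) (measurable_pi_lambda _ fun i => hent i k)]
    rfl
  have hind : ∀ k, IndepFun (fun ω => Function.update (C ω) k 0) (fun ω => C ω k) μ := by
    intro k
    have h := hindep.indepFun_finset (Finset.univ.filter fun p : Fin M × Fin K => p.2 ≠ k)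
      (Finset.univ.filter fun p : Fin M × Fin K => p.2 = k)
      (by rw [Finset.disjoint_left]; intro p; simp) (fun p => hent p.1 p.2)
    let φ : ((Finset.univ.filter fun p : Fin M × Fin K => p.2 ≠ k) → ℂ) →
        Fin K → EuclideanSpace ℂ (Fin M) := fun f j =>
      if hj : j ≠ k then WithLp.toLp 2 (fun i => f ⟨(i, j), by simpa using hj⟩) else 0
    let ψ : ((Finset.univ.filter fun p : Fin M × Fin K => p.2 = k) → ℂ) →
        EuclideanSpace ℂ (Fin M) := fun f => WithLp.toLp 2 (fun i => f ⟨(i, k), by simp⟩)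
    have hφ : Measurable φ := by
      refine measurable_pi_lambda _ fun j => ?_
      by_cases hj : j ≠ k
      · simp only [φ, dif_pos hj]; fun_prop
      · simp only [φ, dif_neg hj]; fun_prop
    have hψ : Measurable ψ := by fun_prop
    have h' := h.comp hφ hψ
    have e1 : (fun ω => Function.update (C ω) k 0) =
        φ ∘ fun a i => X a i.1.1 i.1.2 := by
     ext1 ω
     ext1 j
     by_cases hj : j = k
     · subst hj; simp [φ]
     · simp [φ, hj, hCdef]
    rw [e1]
    exact h'
  refine ⟨?_, ?_⟩
  · filter_upwards [ae_li hMK hd hC hind hlaw Finset.univ] with ω hω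
    have hx' : LinearIndependent ℂ (C ω) := by simpa using hω
    rw [hgram, Matrix.isUnit_iff_isUnit_det]
    exact isUnit_iff_ne_zero.2 (det_gram_ne_zero_iff_linearIndependent.2 hx')
  · have htr : ∀ ω, Matrix.trace (Dhat * ((X ω)ᴴ * X ω)⁻¹)
        = ∑ k, Dhat k k * (gram ℂ (C ω))⁻¹ k k := by
      intro ω
      rw [hgram, Matrix.trace]
      refine Finset.sum_congr rfl fun k _ => ?_
      rw [Matrix.diag_apply, Matrix.mul_apply, Finset.sum_eq_single k]
      · intro j _ hj
        rw [hDhat k j hj.symm, zero_mul]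
      · simp
    simp_rw [htr]
    have hI := fun k => integral_gram_inv hMK hd hC hind hlaw k
    rw [integral_finsetSum _ fun k _ => (hI k).1.const_mul _, Finset.mul_sum]
    refine Finset.sum_congr rfl fun k _ => ?_
    rw [integral_const_mul, (hI k).2]
    push_cast
    have h1 : ((d k : ℝ) : ℂ) ≠ 0 := by exact_mod_cast (hd k).ne'
    have h2 : (M : ℂ) - K ≠ 0 := by
      rw [sub_ne_zero]
      exact_mod_cast hMK.ne'
    field_simp
end

section
/- Let M > K ≥ 1 and let Ĝ be a random M×K complex matrix whose entries are mutually independent, with every entry in column k distributed as CN(0, σ_k²) where σ_k² > 0. Then E{ Tr[ (Ĝ^T Ĝ^*)^{-1} ] } = (1/(M−K)) · Σ_{k=1}^{K} 1/σ_k². -/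
open MeasureTheory ProbabilityTheory Matrix Filter

theorem aux_lintegral_pi_prod {n : ℕ} {E : Type*} [MeasurableSpace E]
    (ν : Fin n → Measure E) [∀ i, SigmaFinite (ν i)]
    (f : Fin n → E → ENNReal) (hf : ∀ i, Measurable (f i)) :
    ∫⁻ x : Fin n → E, ∏ i, f i (x i) ∂(Measure.pi ν) = ∏ i, ∫⁻ x, f i x ∂(ν i) := by
  induction n with
  | zero => simp
  | succ n ih =>
    have h := (measurePreserving_piFinSuccAbove ν 0).symm
    rw [← h.lintegral_comp (by fun_prop)]
    rw [Fin.prod_univ_succ, ← ih (fun i => ν i.succ) (fun i => f i.succ) (fun i => hf _),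
      ← lintegral_prod_mul (hf 0).aemeasurable (Finset.measurable_prod _ fun i _ =>
        (hf i.succ).comp (measurable_pi_apply i)).aemeasurable]
    refine lintegral_congr fun x => ?_
    rw [Fin.prod_univ_succ]
    rfl

theorem aux_pi_withDensity {n : ℕ} {E : Type*} [MeasurableSpace E]
    (ν : Measure E) [SigmaFinite ν] (f : E → ENNReal) (hf : Measurable f)
    [SigmaFinite (ν.withDensity f)] :
    Measure.pi (fun _ : Fin n => ν.withDensity f)
      = (Measure.pi (fun _ : Fin n => ν)).withDensity (fun x => ∏ i, f (x i)) := by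
  refine Measure.pi_eq fun s hs => ?_
  rw [withDensity_apply _ (MeasurableSet.univ_pi hs), Measure.restrict_pi_pi,
    aux_lintegral_pi_prod _ _ (fun _ => hf)]
  refine Finset.prod_congr rfl fun i _ => ?_
  rw [withDensity_apply _ (hs i)]

theorem aux_cg_density (s : ℝ) (hs : 0 < s) :
    complexGaussian s = (volume : Measure ℂ).withDensity
      (fun z => ENNReal.ofReal (1 / (Real.pi * s) * Real.exp (- (1 / s) * ‖z‖ ^ 2))) := by
  have hv : (s / 2).toNNReal ≠ 0 := by
    simp only [ne_eq, Real.toNNReal_eq_zero, not_le]; positivity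
  have e := Complex.volume_preserving_equiv_real_prod.symm
  unfold complexGaussian
  rw [gaussianReal_of_var_ne_zero _ hv, prod_withDensity (measurable_gaussianPDF _ _)
    (measurable_gaussianPDF _ _)]
  ext t ht
  have hm : Measurable (fun p : ℝ × ℝ => (⟨p.1, p.2⟩ : ℂ)) :=
    Complex.measurableEquivRealProd.symm.measurable
  rw [Measure.map_apply hm ht, withDensity_apply _ (hm ht), withDensity_apply _ ht]
  rw [← e.setLIntegral_comp_preimage ht (by fun_prop)]
  refine setLIntegral_congr_fun (hm ht) fun p _ => ?_
  simp only [gaussianPDF]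
  rw [← ENNReal.ofReal_mul (gaussianPDFReal_nonneg _ _ _)]
  congr 1
  simp only [gaussianPDFReal, Real.coe_toNNReal _ (show 0 ≤ s / 2 by positivity)]
  have h2 : ‖Complex.measurableEquivRealProd.symm p‖ ^ 2 = p.1 ^ 2 + p.2 ^ 2 := by
    rw [← Complex.normSq_eq_norm_sq, Complex.normSq_apply]
    simp [Complex.measurableEquivRealProd]
    ring
  rw [h2]
  rw [mul_mul_mul_comm, ← Real.exp_add, ← mul_inv, Real.mul_self_sqrt (by positivity)]
  congr 1
  · field_simp
  · congr 1; field_simp; ring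

theorem aux_cg_exp (s a : ℝ) (hs : 0 < s) (ha : 0 ≤ a) :
    ∫⁻ z, ENNReal.ofReal (Real.exp (-(a * ‖z‖ ^ 2))) ∂(complexGaussian s)
      = ENNReal.ofReal (1 / (1 + a * s)) := by
  rw [aux_cg_density s hs, lintegral_withDensity_eq_lintegral_mul _ (by fun_prop) (by fun_prop)]
  have hb : 0 < a + 1 / s := by positivity
  have h1 : ∀ z : ℂ, ENNReal.ofReal (1 / (Real.pi * s) * Real.exp (- (1 / s) * ‖z‖ ^ 2))
      * ENNReal.ofReal (Real.exp (-(a * ‖z‖ ^ 2)))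
      = ENNReal.ofReal (1 / (Real.pi * s) * Real.exp (-(a + 1 / s) * ‖z‖ ^ 2)) := by
    intro z
    rw [← ENNReal.ofReal_mul (by positivity), mul_assoc, ← Real.exp_add]
    congr 3; ring
  simp only [Pi.mul_apply, h1]
  have h2 := GaussianFourier.integral_rexp_neg_mul_sq_norm (V := ℂ) hb
  have h3 : Integrable (fun z : ℂ => Real.exp (-(a + 1 / s) * ‖z‖ ^ 2)) := by
    by_contra h
    rw [integral_undef h] at h2
    have : (0:ℝ) < (Real.pi / (a + 1 / s)) ^ (Module.finrank ℝ ℂ / 2 : ℝ) := by positivity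
    linarith
  rw [← ofReal_integral_eq_lintegral_ofReal (h3.const_mul _)
    (Filter.Eventually.of_forall fun z => by positivity), integral_const_mul, h2]
  congr 1
  rw [Complex.finrank_real_complex]
  norm_num
  field_simp
  ring

theorem aux_cg_prob (s : ℝ) : IsProbabilityMeasure (complexGaussian s) := by
  unfold complexGaussian
  exact Measure.isProbabilityMeasure_map
    (Complex.measurableEquivRealProd.symm.measurable.aemeasurable)

theorem aux_inv_eq_lintegral (x : ℝ) (hx : 0 ≤ x) :
    (ENNReal.ofReal x)⁻¹ = ∫⁻ t in Set.Ioi (0 : ℝ), ENNReal.ofReal (Real.exp (-(t * x))) := by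
  rcases hx.eq_or_lt with rfl | hx
  · simp
  · have h := integral_exp_mul_Ioi (a := -x) (by linarith) 0
    have hi := integrableOn_exp_mul_Ioi (a := -x) (by linarith) 0
    have h1 : ∀ t : ℝ, -(t * x) = -x * t := fun t => by ring
    simp only [h1]
    rw [← ofReal_integral_eq_lintegral_ofReal hi
      (Filter.Eventually.of_forall fun z => by positivity), h, ← ENNReal.ofReal_inv_of_pos hx]
    congr 1
    simp

theorem aux_int_pow (s : ℝ) (hs : 0 < s) (n : ℕ) (hn : 2 ≤ n) :
    ∫⁻ t in Set.Ioi (0 : ℝ), ENNReal.ofReal ((1 / (1 + t * s)) ^ n)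
      = ENNReal.ofReal (1 / (s * ((n : ℝ) - 1))) := by
  obtain ⟨m, rfl⟩ : ∃ m, n = m + 2 := ⟨n - 2, by omega⟩
  have hd : ∀ x ∈ Set.Ici (0 : ℝ), HasDerivAt
      (fun t => -(1 / (s * ((m : ℝ) + 1)) * ((1 + t * s)⁻¹) ^ (m + 1)))
      ((1 / (1 + x * s)) ^ (m + 2)) x := by
    intro x hx
    have hx : 0 ≤ x := hx
    have hp : 1 + x * s ≠ 0 := by positivity
    have h1 : HasDerivAt (fun t => 1 + t * s) s x := by
      simpa using ((hasDerivAt_id x).mul_const s).const_add 1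
    have h2 := (((h1.inv hp).pow (m + 1)).const_mul (1 / (s * ((m : ℝ) + 1)))).neg
    refine HasDerivAt.congr_deriv (f := fun t => -(1 / (s * ((m : ℝ) + 1)) *
      ((1 + t * s)⁻¹) ^ (m + 1))) h2 ?_
    have : (m : ℝ) + 1 ≠ 0 := by positivity
    push_cast
    simp only [Pi.inv_apply, add_tsub_cancel_right, one_div, inv_pow]
    field_simp
    ring
  have hpos : ∀ x ∈ Set.Ioi (0 : ℝ), 0 ≤ (1 / (1 + x * s)) ^ (m + 2) := by
    intro x hx
    have hx : 0 < x := hx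
    positivity
  have ht : Tendsto (fun t => -(1 / (s * ((m : ℝ) + 1)) * ((1 + t * s)⁻¹) ^ (m + 1))) atTop
      (nhds 0) := by
    have h1 : Tendsto (fun t : ℝ => (1 + t * s)⁻¹) atTop (nhds 0) :=
      tendsto_inv_atTop_zero.comp
        (tendsto_atTop_add_const_left _ _ (tendsto_id.atTop_mul_const hs))
    simpa using ((h1.pow (m + 1)).const_mul (1 / (s * ((m : ℝ) + 1)))).neg
  rw [← ofReal_integral_eq_lintegral_ofReal (integrableOn_Ioi_deriv_of_nonneg' hd hpos ht)
      ((ae_restrict_iff' measurableSet_Ioi).2 (Filter.Eventually.of_forall hpos)),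
      integral_Ioi_of_hasDerivAt_of_nonneg' hd hpos ht]
  congr 1
  push_cast
  simp only [zero_mul, add_zero, inv_one, one_pow, mul_one, zero_sub, neg_neg]
  congr 2
  ring

/-- unitary invariance -/
theorem aux_unitary_inv {M : ℕ} (s : ℝ) (hs : 0 < s) (U : Matrix (Fin M) (Fin M) ℂ)
    (hU : Uᴴ * U = 1) :
    Measure.map (fun g => U *ᵥ g) (Measure.pi (fun _ : Fin M => complexGaussian s))
      = Measure.pi (fun _ : Fin M => complexGaussian s) := by
  have := aux_cg_prob s
  have hU' : U * Uᴴ = 1 := mul_eq_one_comm.1 hU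
  let L : (Fin M → ℂ) →ₗ[ℝ] (Fin M → ℂ) := (Matrix.mulVecLin U).restrictScalars ℝ
  have hL : ∀ g, L g = U *ᵥ g := fun g => rfl
  have hsurj : Function.Surjective L := fun g => ⟨Uᴴ *ᵥ g, by
    rw [hL, mulVec_mulVec, hU', one_mulVec]⟩
  have hLm : Measurable (fun g : Fin M → ℂ => U *ᵥ g) :=
    (L.continuous_of_finiteDimensional).measurable
  obtain ⟨c, -, hc⟩ := L.exists_map_addHaar_eq_smul_addHaar
    (volume : Measure (Fin M → ℂ)) (volume : Measure (Fin M → ℂ)) hsurj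
  let f : (Fin M → ℂ) → ENNReal := fun x =>
    ∏ i, ENNReal.ofReal (1 / (Real.pi * s) * Real.exp (- (1 / s) * ‖x i‖ ^ 2))
  have hfm : Measurable f := by fun_prop
  have hγ : Measure.pi (fun _ : Fin M => complexGaussian s)
      = (volume : Measure (Fin M → ℂ)).withDensity f := by
    have h := aux_cg_density s hs
    have : SigmaFinite ((volume : Measure ℂ).withDensity
      (fun z => ENNReal.ofReal (1 / (Real.pi * s) * Real.exp (- (1 / s) * ‖z‖ ^ 2)))) := by
      rw [← h]; infer_instance
    simp only [h]
    rw [aux_pi_withDensity _ _ (by fun_prop)]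
    rfl
  have hnorm : ∀ x : Fin M → ℂ, ∑ i, ‖(U *ᵥ x) i‖ ^ 2 = ∑ i, ‖x i‖ ^ 2 := by
    have key : ∀ y : Fin M → ℂ, ((∑ i, ‖y i‖ ^ 2 : ℝ) : ℂ) = star y ⬝ᵥ y := by
      intro y
      simp only [dotProduct, Pi.star_apply]
      push_cast
      refine Finset.sum_congr rfl fun i _ => ?_
      rw [Complex.star_def, Complex.conj_mul']
    intro x
    have : ((∑ i, ‖(U *ᵥ x) i‖ ^ 2 : ℝ) : ℂ) = ((∑ i, ‖x i‖ ^ 2 : ℝ) : ℂ) := by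
      rw [key, key, star_mulVec, ← dotProduct_mulVec, mulVec_mulVec, hU, one_mulVec]
    exact_mod_cast this
  have hf : ∀ x, f (U *ᵥ x) = f x := by
    have key : ∀ x, f x = ENNReal.ofReal ((1 / (Real.pi * s)) ^ M *
        Real.exp (-(1 / s) * ∑ i, ‖x i‖ ^ 2)) := by
      intro x
      simp only [f]
      rw [← ENNReal.ofReal_prod_of_nonneg (fun i _ => by positivity), Finset.prod_mul_distrib,
        ← Real.exp_sum, Finset.mul_sum]
      simp
    intro x
    rw [key, key, hnorm]
  have hmap : Measure.map (fun g => U *ᵥ g) (Measure.pi (fun _ : Fin M => complexGaussian s))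
      = c • Measure.pi (fun _ : Fin M => complexGaussian s) := by
    rw [hγ]
    ext t ht
    rw [Measure.map_apply hLm ht, withDensity_apply _ (hLm ht), Measure.smul_apply,
      withDensity_apply _ ht, ← lintegral_smul_measure, ← Measure.restrict_smul, ← hc]
    change _ = ∫⁻ a in t, f a ∂(Measure.map (fun g => U *ᵥ g) volume)
    rw [setLIntegral_map ht hfm hLm]
    simp only [hf]
  have h1 := congrArg (fun m : Measure (Fin M → ℂ) => m Set.univ) hmap
  simp only [Measure.map_apply hLm MeasurableSet.univ, Set.preimage_univ, measure_univ,
    Measure.smul_apply, smul_eq_mul, mul_one] at h1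
  rw [hmap, ← h1, one_smul]

theorem aux_quad {M : ℕ} (s : ℝ) (hs : 0 < s) (P : Matrix (Fin M) (Fin M) ℂ)
    (hP : P.IsHermitian) (hPP : P * P = P) (n : ℕ) (hn : 2 ≤ n) (htr : P.trace = (n : ℂ)) :
    ∫⁻ g, (ENNReal.ofReal (star g ⬝ᵥ P *ᵥ g).re)⁻¹
        ∂(Measure.pi (fun _ : Fin M => complexGaussian s))
      = ENNReal.ofReal (1 / (s * ((n : ℝ) - 1))) := by
  have := aux_cg_prob s
  let U : Matrix (Fin M) (Fin M) ℂ := hP.eigenvectorUnitary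
  let l := hP.eigenvalues
  let D : Matrix (Fin M) (Fin M) ℂ := diagonal (fun i => (l i : ℂ))
  have hUU : Uᴴ * U = 1 := Unitary.coe_star_mul_self hP.eigenvectorUnitary
  have hUU' : U * Uᴴ = 1 := Unitary.coe_mul_star_self hP.eigenvectorUnitary
  have hspec : P = U * D * Uᴴ := by
    have h := hP.spectral_theorem
    rw [Unitary.conjStarAlgAut_apply] at h
    exact h
  have hDD : D * D = D := by
    have h : Uᴴ * P * U = D := by
      rw [hspec]
      calc Uᴴ * (U * D * Uᴴ) * U = (Uᴴ * U) * D * (Uᴴ * U) := by simp only [Matrix.mul_assoc]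
        _ = D := by rw [hUU]; simp
    calc D * D = Uᴴ * P * (U * Uᴴ) * P * U := by rw [← h]; simp only [Matrix.mul_assoc]
      _ = Uᴴ * (P * P) * U := by rw [hUU']; simp only [Matrix.mul_assoc, Matrix.one_mul]
      _ = D := by rw [hPP, h]
  have hl : ∀ i, l i = 0 ∨ l i = 1 := by
    intro i
    have h := congrFun (congrFun hDD i) i
    simp only [D, diagonal_mul_diagonal, diagonal_apply_eq] at h
    have h' : l i * l i = l i := by exact_mod_cast h
    rcases eq_or_ne (l i) 0 with h0 | h0
    · exact Or.inl h0
    · exact Or.inr (mul_left_cancel₀ h0 (by rw [h', mul_one]))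
  have hsum : ∑ i, l i = n := by
    have h := hP.trace_eq_sum_eigenvalues
    rw [htr] at h
    have h2 : ((∑ i, l i : ℝ) : ℂ) = n := by rw [h]; push_cast; rfl
    exact_mod_cast h2
  have hq : ∀ g : Fin M → ℂ, (star g ⬝ᵥ P *ᵥ g).re = ∑ i, l i * ‖(Uᴴ *ᵥ g) i‖ ^ 2 := by
    intro g
    have h : star g ⬝ᵥ P *ᵥ g = ((∑ i, l i * ‖(Uᴴ *ᵥ g) i‖ ^ 2 : ℝ) : ℂ) := by
      have e1 : star g ⬝ᵥ P *ᵥ g = star (Uᴴ *ᵥ g) ⬝ᵥ (D *ᵥ (Uᴴ *ᵥ g)) := by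
        rw [star_mulVec, conjTranspose_conjTranspose, ← dotProduct_mulVec, mulVec_mulVec,
          mulVec_mulVec, ← hspec]
      rw [e1]
      simp only [dotProduct, D, mulVec_diagonal, Pi.star_apply]
      push_cast
      refine Finset.sum_congr rfl fun i _ => ?_
      rw [Complex.star_def, mul_left_comm, Complex.conj_mul']
    rw [h, Complex.ofReal_re]
  have hmeas : Measurable (fun g : Fin M → ℂ => Uᴴ *ᵥ g) :=
    (LinearMap.continuous_of_finiteDimensional (Matrix.mulVecLin Uᴴ)).measurable
  have hnn : ∀ y : Fin M → ℂ, 0 ≤ ∑ i, l i * ‖y i‖ ^ 2 := fun y =>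
    Finset.sum_nonneg fun i _ => by
      rcases hl i with h | h <;> rw [h] <;> positivity
  simp only [hq]
  have hstep : ∫⁻ g, (ENNReal.ofReal (∑ i, l i * ‖(Uᴴ *ᵥ g) i‖ ^ 2))⁻¹
        ∂(Measure.pi (fun _ : Fin M => complexGaussian s))
      = ∫⁻ y, (ENNReal.ofReal (∑ i, l i * ‖y i‖ ^ 2))⁻¹
        ∂(Measure.pi (fun _ : Fin M => complexGaussian s)) := by
    conv_rhs => rw [← aux_unitary_inv s hs Uᴴ (by rw [conjTranspose_conjTranspose, hUU'])]
    rw [lintegral_map (by fun_prop) hmeas]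
  rw [hstep]
  have hstep2 : ∀ y : Fin M → ℂ, (ENNReal.ofReal (∑ i, l i * ‖y i‖ ^ 2))⁻¹
      = ∫⁻ t in Set.Ioi (0 : ℝ), ∏ i, ENNReal.ofReal (Real.exp (-(t * l i * ‖y i‖ ^ 2))) := by
    intro y
    rw [aux_inv_eq_lintegral _ (hnn y)]
    refine lintegral_congr fun t => ?_
    rw [← ENNReal.ofReal_prod_of_nonneg (fun i _ => by positivity), ← Real.exp_sum]
    congr 2
    rw [Finset.mul_sum, ← Finset.sum_neg_distrib]
    exact Finset.sum_congr rfl fun i _ => by ring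
  simp only [hstep2]
  rw [lintegral_lintegral_swap (by fun_prop), ← aux_int_pow s hs n hn]
  refine setLIntegral_congr_fun measurableSet_Ioi fun t ht => ?_
  have ht : 0 < t := ht
  rw [aux_lintegral_pi_prod (fun _ : Fin M => complexGaussian s)
    (fun i z => ENNReal.ofReal (Real.exp (-(t * l i * ‖z‖ ^ 2)))) (fun i => by fun_prop)]
  have h1 : ∀ i, ∫⁻ z, ENNReal.ofReal (Real.exp (-(t * l i * ‖z‖ ^ 2))) ∂(complexGaussian s)
      = ENNReal.ofReal ((1 / (1 + t * s)) ^ (l i)) := by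
    intro i
    rw [aux_cg_exp s _ hs (by rcases hl i with h | h <;> rw [h] <;> simp [ht.le])]
    rcases hl i with h | h <;> rw [h] <;> simp
  simp only [h1]
  have hp : 0 < 1 / (1 + t * s) := by positivity
  rw [← ENNReal.ofReal_prod_of_nonneg (fun i _ => by positivity), ← Real.rpow_sum_of_pos hp, hsum,
    Real.rpow_natCast]

/-- projection onto the orthogonal complement of the column space -/
noncomputable def auxProj {M l : ℕ} (H : Matrix (Fin M) (Fin l) ℂ) : Matrix (Fin M) (Fin M) ℂ :=
  1 - H * (Hᴴ * H)⁻¹ * Hᴴ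

theorem auxProj_herm {M l : ℕ} (H : Matrix (Fin M) (Fin l) ℂ) : (auxProj H).IsHermitian := by
  unfold Matrix.IsHermitian auxProj
  simp only [conjTranspose_sub, conjTranspose_one, conjTranspose_mul, conjTranspose_conjTranspose,
    conjTranspose_nonsing_inv, Matrix.mul_assoc]

theorem auxProj_idem {M l : ℕ} (H : Matrix (Fin M) (Fin l) ℂ) (h : (Hᴴ * H).det ≠ 0) :
    auxProj H * auxProj H = auxProj H := by
  have hu : IsUnit (Hᴴ * H).det := isUnit_iff_ne_zero.2 h
  have h1 : (H * (Hᴴ * H)⁻¹ * Hᴴ) * (H * (Hᴴ * H)⁻¹ * Hᴴ) = H * (Hᴴ * H)⁻¹ * Hᴴ := by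
    calc _ = H * ((Hᴴ * H)⁻¹ * (Hᴴ * H)) * (Hᴴ * H)⁻¹ * Hᴴ := by simp only [Matrix.mul_assoc]
      _ = _ := by rw [nonsing_inv_mul _ hu, Matrix.mul_one]
  unfold auxProj
  rw [Matrix.sub_mul, Matrix.mul_sub, Matrix.mul_sub, h1]
  simp

theorem auxProj_trace {M l : ℕ} (H : Matrix (Fin M) (Fin l) ℂ) (h : (Hᴴ * H).det ≠ 0) :
    (auxProj H).trace = (M : ℂ) - l := by
  have hu : IsUnit (Hᴴ * H).det := isUnit_iff_ne_zero.2 h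
  unfold auxProj
  rw [trace_sub, trace_one, Matrix.trace_mul_comm, ← Matrix.mul_assoc, mul_nonsing_inv _ hu,
    trace_one]
  simp

theorem auxProj_quad {M l : ℕ} (H : Matrix (Fin M) (Fin l) ℂ) (h : (Hᴴ * H).det ≠ 0)
    (g : Fin M → ℂ) :
    star g ⬝ᵥ auxProj H *ᵥ g = ((star g ⬝ᵥ auxProj H *ᵥ g).re : ℂ) ∧
      0 ≤ (star g ⬝ᵥ auxProj H *ᵥ g).re := by
  have h1 : star g ⬝ᵥ auxProj H *ᵥ g = ((∑ i, ‖(auxProj H *ᵥ g) i‖ ^ 2 : ℝ) : ℂ) := by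
    have e : star g ⬝ᵥ auxProj H *ᵥ g = star (auxProj H *ᵥ g) ⬝ᵥ auxProj H *ᵥ g := by
      rw [star_mulVec, auxProj_herm, ← dotProduct_mulVec, mulVec_mulVec, auxProj_idem H h]
    rw [e]
    simp only [dotProduct, Pi.star_apply]
    push_cast
    refine Finset.sum_congr rfl fun i _ => ?_
    rw [Complex.star_def, Complex.conj_mul']
  rw [h1, Complex.ofReal_re]
  exact ⟨rfl, by positivity⟩

theorem aux_schur {M l : ℕ} (B : Matrix (Fin M) (Fin (l + 1)) ℂ) (k : Fin (l + 1))
    (H : Matrix (Fin M) (Fin l) ℂ) (hH : H = B.submatrix id k.succAbove)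
    (h : (Hᴴ * H).det ≠ 0) :
    (Bᴴ * B).det = (Hᴴ * H).det * (star (fun i => B i k) ⬝ᵥ auxProj H *ᵥ (fun i => B i k)) := by
  have hu : IsUnit (Hᴴ * H).det := isUnit_iff_ne_zero.2 h
  let e : Fin l ⊕ Unit ≃ Fin (l + 1) :=
    ((finSuccEquiv' k).trans (Equiv.optionEquivSumPUnit _)).symm
  have e1 : ∀ j, e (Sum.inl j) = k.succAbove j := by intro j; simp [e]
  have e2 : ∀ u, e (Sum.inr u) = k := by intro j; simp [e]
  let g : Matrix (Fin M) Unit ℂ := Matrix.of fun i _ => B i k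
  have hb : (Bᴴ * B).submatrix e e = fromBlocks (Hᴴ * H) (Hᴴ * g) (gᴴ * H) (gᴴ * g) := by
    ext (i | i) (j | j) <;> simp [Matrix.mul_apply, e1, e2, hH, g]
  let := invertibleOfIsUnitDet _ hu
  rw [← det_submatrix_equiv_self e, hb, det_fromBlocks₁₁, det_unique (n := Unit)]
  congr 1
  have h3 : gᴴ * g - gᴴ * H * ⅟(Hᴴ * H) * (Hᴴ * g) = gᴴ * (auxProj H * g) := by
    unfold auxProj
    rw [invOf_eq_nonsing_inv, Matrix.sub_mul, Matrix.mul_sub]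
    simp only [Matrix.mul_assoc, Matrix.one_mul]
  rw [h3]
  simp [Matrix.mul_apply, dotProduct, mulVec, g]

theorem aux_quad_meas {M l : ℕ} : Measurable
    (fun p : (Fin M → ℂ) × (Fin M → Fin l → ℂ) =>
      star p.1 ⬝ᵥ auxProj (Matrix.of p.2) *ᵥ p.1) := by
  have h1 : ∀ p : (Fin M → ℂ) × (Fin M → Fin l → ℂ),
      star p.1 ⬝ᵥ auxProj (Matrix.of p.2) *ᵥ p.1 = star p.1 ⬝ᵥ p.1 -
        ((Matrix.of p.2)ᴴ * Matrix.of p.2).det⁻¹ *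
        (star p.1 ⬝ᵥ ((Matrix.of p.2) * ((Matrix.of p.2)ᴴ * Matrix.of p.2).adjugate
          * (Matrix.of p.2)ᴴ) *ᵥ p.1) := by
    intro p
    unfold auxProj
    rw [Matrix.inv_def, Ring.inverse_eq_inv', Matrix.sub_mulVec, dotProduct_sub, one_mulVec,
      Matrix.mul_smul, Matrix.smul_mul, smul_mulVec, dotProduct_smul, smul_eq_mul]
  simp only [h1]
  have hc : Continuous (fun p : (Fin M → ℂ) × (Fin M → Fin l → ℂ) => Matrix.of p.2) :=
    continuous_snd
  have c1 : Continuous (fun p : (Fin M → ℂ) × (Fin M → Fin l → ℂ) => star p.1 ⬝ᵥ p.1) := by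
    fun_prop
  have c2 : Continuous (fun p : (Fin M → ℂ) × (Fin M → Fin l → ℂ) =>
      ((Matrix.of p.2)ᴴ * Matrix.of p.2).det) := by
    fun_prop
  have c3 : Continuous (fun p : (Fin M → ℂ) × (Fin M → Fin l → ℂ) =>
      (star p.1 ⬝ᵥ ((Matrix.of p.2) * ((Matrix.of p.2)ᴴ * Matrix.of p.2).adjugate
          * (Matrix.of p.2)ᴴ) *ᵥ p.1)) := by
    fun_prop
  exact c1.measurable.sub (c2.measurable.inv.mul c3.measurable)

theorem aux_det_meas {M l : ℕ} : Measurable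
    (fun p : (Fin M → Fin l → ℂ) => ((Matrix.of p)ᴴ * Matrix.of p).det) := by
  have hc : Continuous (fun p : (Fin M → Fin l → ℂ) => Matrix.of p) := continuous_id
  have c2 : Continuous (fun p : (Fin M → Fin l → ℂ) =>
      ((Matrix.of p)ᴴ * Matrix.of p).det) := by
    fun_prop
  exact c2.measurable

theorem aux_prob
    {Ω : Type*} [MeasurableSpace Ω] (μ : Measure Ω) [IsProbabilityMeasure μ]
    (M K : ℕ)
    (σsq : Fin K → ℝ) (hσ : ∀ k, 0 < σsq k)
    (G : Ω → Matrix (Fin M) (Fin K) ℂ) (hG : ∀ i k, Measurable (fun ω => G ω i k))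
    (hindep : iIndepFun
      (fun (p : Fin M × Fin K) ω => G ω p.1 p.2) μ)
    (hdist : ∀ i k, μ.map (fun ω => G ω i k) = complexGaussian (σsq k))
    (l : ℕ) (hl : l + 1 < M) (f : Fin l → Fin K) (k : Fin K) (hk : ∀ j, f j ≠ k)
    (hdet : ∀ᵐ ω ∂μ, (((G ω).submatrix id f)ᴴ * ((G ω).submatrix id f)).det ≠ 0) :
    ∫⁻ ω, (ENNReal.ofReal (star (fun i => G ω i k) ⬝ᵥ
      auxProj ((G ω).submatrix id f) *ᵥ (fun i => G ω i k)).re)⁻¹ ∂μ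
      = ENNReal.ofReal (1 / (σsq k * ((M : ℝ) - l - 1))) := by
  let X : Ω → (Fin M → ℂ) := fun ω i => G ω i k
  let Y : Ω → (Fin M → Fin l → ℂ) := fun ω i j => G ω i (f j)
  have hX : Measurable X := measurable_pi_lambda _ fun i => hG _ _
  have hY : Measurable Y := measurable_pi_lambda _ fun i => measurable_pi_lambda _ fun j => hG _ _
  have hXlaw : μ.map X = Measure.pi (fun _ : Fin M => complexGaussian (σsq k)) := by
    have h1 : iIndepFun (fun (i : Fin M) ω => G ω i k) μ :=
      hindep.precomp (g := fun i : Fin M => (i, k)) (fun a b h => (Prod.ext_iff.1 h).1)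
    have h2 := (iIndepFun_iff_map_fun_eq_pi_map (fun i => (hG i k).aemeasurable)).1 h1
    simp only [hdist] at h2
    exact h2
  have hXY : IndepFun X Y μ := by
    classical
    let S : Finset (Fin M × Fin K) := Finset.univ ×ˢ {k}
    let T : Finset (Fin M × Fin K) := Finset.univ ×ˢ Finset.univ.image f
    have hST : Disjoint S T := by
      rw [Finset.disjoint_left]
      rintro ⟨a, b⟩ h1 h2
      simp only [S, T, Finset.mem_product, Finset.mem_univ, Finset.mem_singleton, true_and,
        Finset.mem_image] at h1 h2
      obtain ⟨j, hj⟩ := h2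
      exact hk j (hj.trans h1)
    have h := hindep.indepFun_finset S T hST (fun p => hG p.1 p.2)
    have hS : ∀ i : Fin M, (i, k) ∈ S := fun i => by simp [S]
    have hT : ∀ (i : Fin M) (j : Fin l), (i, f j) ∈ T := fun i j => by simp [T]
    have hφ : Measurable (fun (v : S → ℂ) (i : Fin M) => v ⟨(i, k), hS i⟩) := by fun_prop
    have hψ : Measurable (fun (v : T → ℂ) (i : Fin M) (j : Fin l) => v ⟨(i, f j), hT i j⟩) := by
      fun_prop
    exact h.comp hφ hψ
  have hmap := (indepFun_iff_map_prod_eq_prod_map_map hX.aemeasurable hY.aemeasurable).1 hXY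
  have hF : Measurable (fun p : (Fin M → ℂ) × (Fin M → Fin l → ℂ) =>
      (ENNReal.ofReal (star p.1 ⬝ᵥ auxProj (Matrix.of p.2) *ᵥ p.1).re)⁻¹) :=
    (Complex.measurable_re.comp aux_quad_meas).ennreal_ofReal.inv
  have hs := lintegral_map (μ := μ) hF (hX.prodMk hY)
  have := Measure.isProbabilityMeasure_map (μ := μ) hY.aemeasurable
  have := Measure.isProbabilityMeasure_map (μ := μ) hX.aemeasurable
  rw [hmap, lintegral_prod_symm' _ hF] at hs
  refine hs.symm.trans ?_
  have hdet' : ∀ᵐ H ∂(μ.map Y), ((Matrix.of H)ᴴ * Matrix.of H).det ≠ 0 := by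
    exact (ae_map_iff hY.aemeasurable
      (aux_det_meas (measurableSet_singleton (0 : ℂ)).compl)).2 hdet
  have hc : ∀ᵐ H ∂(μ.map Y), ∫⁻ g, (ENNReal.ofReal
      (star g ⬝ᵥ auxProj (Matrix.of H) *ᵥ g).re)⁻¹ ∂(μ.map X)
      = ENNReal.ofReal (1 / (σsq k * ((M : ℝ) - l - 1))) := by
    filter_upwards [hdet'] with H hH
    rw [hXlaw, aux_quad (σsq k) (hσ k) (auxProj (Matrix.of H)) (auxProj_herm _)
      (auxProj_idem _ hH) (M - l) (by omega)
      (by rw [auxProj_trace _ hH, Nat.cast_sub (by omega)])]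
    rw [Nat.cast_sub (by omega)]
  rw [lintegral_congr_ae hc]
  simp

theorem aux_ae
    {Ω : Type*} [MeasurableSpace Ω] (μ : Measure Ω) [IsProbabilityMeasure μ]
    (M K : ℕ) (hMK : K < M)
    (σsq : Fin K → ℝ) (hσ : ∀ k, 0 < σsq k)
    (G : Ω → Matrix (Fin M) (Fin K) ℂ) (hG : ∀ i k, Measurable (fun ω => G ω i k))
    (hindep : iIndepFun
      (fun (p : Fin M × Fin K) ω => G ω p.1 p.2) μ)
    (hdist : ∀ i k, μ.map (fun ω => G ω i k) = complexGaussian (σsq k))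
    (l : ℕ) (f : Fin l → Fin K) (hf : Function.Injective f) :
    ∀ᵐ ω ∂μ, (((G ω).submatrix id f)ᴴ * ((G ω).submatrix id f)).det ≠ 0 := by
  induction l with
  | zero => simp
  | succ l ih =>
    have hlK : l + 1 ≤ K := by simpa using Fintype.card_le_of_injective f hf
    have hsucc : ∀ j, f (Fin.succAbove 0 j) ≠ f 0 := fun j h =>
      Fin.succAbove_ne 0 j (hf h)
    have ih' := ih (f ∘ Fin.succAbove 0) (hf.comp Fin.succAbove_right_injective)
    have hp := aux_prob μ M K σsq hσ G hG hindep hdist l (by omega) (f ∘ Fin.succAbove 0) (f 0)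
      hsucc ih'
    have hm : Measurable (fun ω => (ENNReal.ofReal (star (fun i => G ω i (f 0)) ⬝ᵥ
      auxProj ((G ω).submatrix id (f ∘ Fin.succAbove 0)) *ᵥ (fun i => G ω i (f 0))).re)⁻¹) :=
      (Complex.measurable_re.comp (aux_quad_meas.comp
        ((measurable_pi_lambda _ fun i => hG i (f 0)).prodMk
        (measurable_pi_lambda _ fun i => measurable_pi_lambda _
          fun j => hG i (f (Fin.succAbove 0 j)))))).ennreal_ofReal.inv
    have hfin := ae_lt_top hm (by rw [hp]; exact ENNReal.ofReal_ne_top)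
    filter_upwards [ih', hfin] with ω h1 h2
    rw [aux_schur ((G ω).submatrix id f) 0 ((G ω).submatrix id (f ∘ Fin.succAbove 0)) rfl h1]
    refine mul_ne_zero h1 fun h0 => ?_
    simp only [submatrix_apply, id_eq] at h0
    rw [h0] at h2
    simp at h2

theorem stmt_8
    {Ω : Type*} [MeasurableSpace Ω] (μ : Measure Ω) [IsProbabilityMeasure μ]
    (M K : ℕ) (hK : 1 ≤ K) (hMK : K < M)
    (σsq : Fin K → ℝ) (hσ : ∀ k, 0 < σsq k)
    (G : Ω → Matrix (Fin M) (Fin K) ℂ) (hG : Measurable G)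
    (hindep : iIndepFun
      (fun (p : Fin M × Fin K) ω => G ω p.1 p.2) μ)
    (hdist : ∀ i k, μ.map (fun ω => G ω i k) = complexGaussian (σsq k)) :
    ∫ ω, Matrix.trace (((G ω)ᵀ * (G ω).map star)⁻¹) ∂μ
      = (1 / ((M : ℂ) - (K : ℂ))) * ∑ k, 1 / (σsq k : ℂ) := by
  have hG' : ∀ i k, Measurable (fun ω => G ω i k) := fun i k =>
    (measurable_pi_apply k).comp ((measurable_pi_apply i).comp hG)
  obtain ⟨L, rfl⟩ : ∃ L, K = L + 1 := ⟨K - 1, by omega⟩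
  have hMpos : (0 : ℝ) < (M : ℝ) - (L + 1) := by
    have : ((L + 1 : ℕ) : ℝ) < M := by exact_mod_cast hMK
    push_cast at this
    linarith
  let q : Fin (L + 1) → Ω → ℝ := fun k ω => (star (fun i => G ω i k) ⬝ᵥ
      auxProj ((G ω).submatrix id k.succAbove) *ᵥ (fun i => G ω i k)).re
  have hqm : ∀ k, Measurable (q k) := fun k =>
    Complex.measurable_re.comp (aux_quad_meas.comp
        ((measurable_pi_lambda _ fun i => hG' i k).prodMk
        (measurable_pi_lambda _ fun i => measurable_pi_lambda _
          fun j => hG' i (k.succAbove j))))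
  have hae : ∀ k : Fin (L + 1), ∀ᵐ ω ∂μ,
      (((G ω).submatrix id k.succAbove)ᴴ * ((G ω).submatrix id k.succAbove)).det ≠ 0 := fun k =>
    aux_ae μ M (L + 1) hMK σsq hσ G hG' hindep hdist L k.succAbove Fin.succAbove_right_injective
  have hae0 : ∀ᵐ ω ∂μ, ((G ω)ᴴ * (G ω)).det ≠ 0 :=
    aux_ae μ M (L + 1) hMK σsq hσ G hG' hindep hdist (L + 1) id Function.injective_id
  have hlint : ∀ k, ∫⁻ ω, (ENNReal.ofReal (q k ω))⁻¹ ∂μ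
      = ENNReal.ofReal (1 / (σsq k * ((M : ℝ) - L - 1))) := fun k =>
    aux_prob μ M (L + 1) σsq hσ G hG' hindep hdist L (by omega) k.succAbove k
      (fun j => Fin.succAbove_ne k j) (hae k)
  have hpt : ∀ k, ∀ᵐ ω ∂μ, 0 < q k ω ∧
      ((G ω)ᴴ * (G ω))⁻¹ k k = (((q k ω)⁻¹ : ℝ) : ℂ) := by
    intro k
    filter_upwards [hae k, hae0] with ω h1 h2
    have hs := aux_schur (G ω) k _ rfl h1
    obtain ⟨hq1, hq2⟩ := auxProj_quad _ h1 (fun i => G ω i k)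
    rw [hq1] at hs
    change _ = _ * ((q k ω : ℝ) : ℂ) at hs
    change 0 ≤ q k ω at hq2
    have hq0 : q k ω ≠ 0 := by
      intro h0
      rw [h0] at hs
      simp at hs
      exact h2 hs
    refine ⟨lt_of_le_of_ne hq2 (Ne.symm hq0), ?_⟩
    rw [Matrix.inv_def, Ring.inverse_eq_inv', Matrix.smul_apply, smul_eq_mul,
      adjugate_fin_succ_eq_det_submatrix, hs]
    have h3 : ((G ω)ᴴ * G ω).submatrix k.succAbove k.succAbove
      = ((G ω).submatrix id k.succAbove)ᴴ * ((G ω).submatrix id k.succAbove) := by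
      ext i j
      simp [Matrix.mul_apply]
    have h4 : (-1 : ℂ) ^ ((k : ℕ) + k) = 1 := Even.neg_one_pow ⟨_, rfl⟩
    have h5 : ((q k ω : ℝ) : ℂ) ≠ 0 := by exact_mod_cast hq0
    rw [h3, h4]
    push_cast
    field_simp
  have hlint2 : ∀ k, ∫⁻ ω, ENNReal.ofReal ((q k ω)⁻¹) ∂μ
      = ENNReal.ofReal (1 / (σsq k * ((M : ℝ) - L - 1))) := by
    intro k
    rw [← hlint k]
    refine lintegral_congr_ae ?_
    filter_upwards [hpt k] with ω h
    exact ENNReal.ofReal_inv_of_pos h.1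
  have hnn : ∀ k, 0 ≤ᵐ[μ] fun ω => (q k ω)⁻¹ := fun k => by
    filter_upwards [hpt k] with ω h
    exact (inv_pos.2 h.1).le
  have hint : ∀ k, Integrable (fun ω => (q k ω)⁻¹) μ := fun k => by
    refine (lintegral_ofReal_ne_top_iff_integrable (hqm k).inv.aestronglyMeasurable (hnn k)).1 ?_
    change ∫⁻ ω, ENNReal.ofReal ((q k ω)⁻¹) ∂μ ≠ _
    rw [hlint2 k]
    exact ENNReal.ofReal_ne_top
  have hval : ∀ k, ∫ ω, (q k ω)⁻¹ ∂μ = 1 / (σsq k * ((M : ℝ) - L - 1)) := fun k => by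
    rw [integral_eq_lintegral_of_nonneg_ae (hnn k) (hqm k).inv.aestronglyMeasurable, hlint2 k,
      ENNReal.toReal_ofReal]
    have := hσ k
    have : 0 < (M : ℝ) - L - 1 := by linarith
    positivity
  have htrace : ∀ᵐ ω ∂μ, Matrix.trace (((G ω)ᵀ * (G ω).map star)⁻¹)
      = ∑ k, (((q k ω)⁻¹ : ℝ) : ℂ) := by
    filter_upwards [ae_all_iff.2 hpt] with ω h
    have ht : (G ω)ᵀ * (G ω).map star = ((G ω)ᴴ * G ω)ᵀ := by
      rw [transpose_mul]
      rfl
    rw [ht, ← transpose_nonsing_inv, trace_transpose]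
    exact Finset.sum_congr rfl fun k _ => (h k).2
  rw [integral_congr_ae htrace, integral_finsetSum _ (fun k _ => (hint k).ofReal), Finset.mul_sum]
  refine Finset.sum_congr rfl fun k _ => ?_
  have hc : ∫ ω, (((q k ω)⁻¹ : ℝ) : ℂ) ∂μ = ((∫ ω, (q k ω)⁻¹ ∂μ : ℝ) : ℂ) := integral_ofReal
  refine hc.trans ?_
  rw [hval k]
  push_cast
  rw [← sub_sub, one_div_mul_one_div, mul_comm]
end
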